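/- arXiv:1410.8236 — 9 statements merged into one kernel-verified Lean document; each statement's English description precedes it below -/
import Mathlib

section
/- Let Ξ₁, Ξ₁₂, e₁, e₁₂, P, P₁, P₁₂, X, Y be polynomials in one variable η over ℝ and let c, ẽ₁, ẽ₁₂, E₁, E₂ be real scalars. Assume (H1) E₁·Ξ₁·P = −c²·e₁·P₁′ + c·ẽ₁·P₁, (H2) E₂·Ξ₁₂·P₁ = c²·e₁₂·(Ξ₁′·P₁₂ − Ξ₁·P₁₂′) + c·ẽ₁₂·Ξ₁·P₁₂, and (H3) X′ = Ξ₁₂·Y, where ′ denotes d/dη. Put G := E₂·X·P₁ − c²·e₁₂·Ξ₁·Y·P₁₂. Then: (C1) c²·e₁₂·(Ξ₁′·X·P₁₂ − Ξ₁·(X·P₁₂)′) + c·ẽ₁₂·Ξ₁·X·P₁₂ = Ξ₁₂·G, and (C2) −c²·e₁·G′ + c·ẽ₁·G = Ξ₁·( E₁·E₂·X·P + c⁴·e₁·(e₁₂·Y·P₁₂)′ + c⁴·e₁·e₁₂·Y·P₁₂′ − c³·(ẽ₁·e₁₂ + e₁·ẽ₁₂)·Y·P₁₂ ). -/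
open Polynomial

theorem stmt_4 (Ξ₁ Ξ₁₂ e₁ e₁₂ P P₁ P₁₂ X Y : ℝ[X]) (c et₁ et₁₂ E₁ E₂ : ℝ)
    (H1 : C E₁ * Ξ₁ * P = -(C (c ^ 2) * e₁ * P₁.derivative) + C c * C et₁ * P₁)
    (H2 : C E₂ * Ξ₁₂ * P₁ =
      C (c ^ 2) * e₁₂ * (Ξ₁.derivative * P₁₂ - Ξ₁ * P₁₂.derivative)
        + C c * C et₁₂ * Ξ₁ * P₁₂)
    (H3 : X.derivative = Ξ₁₂ * Y) :
    (C (c ^ 2) * e₁₂ * (Ξ₁.derivative * (X * P₁₂) - Ξ₁ * (X * P₁₂).derivative)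
        + C c * C et₁₂ * Ξ₁ * (X * P₁₂)
      = Ξ₁₂ * (C E₂ * X * P₁ - C (c ^ 2) * e₁₂ * Ξ₁ * Y * P₁₂)) ∧
    (-(C (c ^ 2) * e₁
          * (C E₂ * X * P₁ - C (c ^ 2) * e₁₂ * Ξ₁ * Y * P₁₂).derivative)
        + C c * C et₁ * (C E₂ * X * P₁ - C (c ^ 2) * e₁₂ * Ξ₁ * Y * P₁₂)
      = Ξ₁ * (C E₁ * C E₂ * X * P
          + C (c ^ 4) * e₁ * (e₁₂ * Y * P₁₂).derivative
          + C (c ^ 4) * e₁ * e₁₂ * Y * P₁₂.derivative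
          - C (c ^ 3) * (C et₁ * e₁₂ + e₁ * C et₁₂) * Y * P₁₂)) := by
  simp only [derivative_mul, derivative_sub, derivative_C, C_pow, derivative_pow] at *
  constructor
  · linear_combination (-X) * H2 - C c ^ 2 * e₁₂ * Ξ₁ * P₁₂ * H3
  · linear_combination (-(C E₂ * X)) * H1 - C c ^ 2 * e₁ * Y * H2 - C c ^ 2 * e₁ * C E₂ * P₁ * H3
end

section
/- Let γ be a nonzero complex number and write η₋(x) = (x − iγ/2)², η₊(x) = (x + iγ/2)², φ(x) = i(η₋(x) − η₊(x)) = 2γx. Let Ξ, X, Y, P̃, P be polynomials over ℂ, e, e* polynomials in x over ℂ, and c, E ∈ ℂ. Assume for all x ∈ ℂ: (i) E·φ(x)·Ξ(x²)·P̃(x²) = i c·( e(x)·P(η₋(x)) − e*(x)·P(η₊(x)) ), and (ii) X(η₋(x)) − X(η₊(x)) = (η₋(x) − η₊(x))·Ξ(x²)·Y(x²). Then for all x ∈ ℂ: i c·( e(x)·X(η₋(x))·P(η₋(x)) − e*(x)·X(η₊(x))·P(η₊(x)) ) = φ(x)·Ξ(x²)·( E·(X(η₋(x)) + X(η₊(x)))/2·P̃(x²)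 + (c/2)·Y(x²)·( e(x)·P(η₋(x)) + e*(x)·P(η₊(x)) ) ). -/
open Polynomial Complex

theorem stmt_6 (γ : ℂ) (hγ : γ ≠ 0) (Ξ X Y Pt P e estar : ℂ[X]) (c E : ℂ)
    (h1 : ∀ x : ℂ,
      E * (2 * γ * x) * Ξ.eval (x ^ 2) * Pt.eval (x ^ 2) =
        I * c * (e.eval x * P.eval ((x - I * γ / 2) ^ 2)
          - estar.eval x * P.eval ((x + I * γ / 2) ^ 2)))
    (h2 : ∀ x : ℂ,
      X.eval ((x - I * γ / 2) ^ 2) - X.eval ((x + I * γ / 2) ^ 2) =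
        ((x - I * γ / 2) ^ 2 - (x + I * γ / 2) ^ 2) * Ξ.eval (x ^ 2)
          * Y.eval (x ^ 2)) :
    ∀ x : ℂ,
      I * c * (e.eval x * X.eval ((x - I * γ / 2) ^ 2)
          * P.eval ((x - I * γ / 2) ^ 2)
        - estar.eval x * X.eval ((x + I * γ / 2) ^ 2)
          * P.eval ((x + I * γ / 2) ^ 2))
      = (2 * γ * x) * Ξ.eval (x ^ 2)
        * (E * ((X.eval ((x - I * γ / 2) ^ 2) + X.eval ((x + I * γ / 2) ^ 2)) / 2)
            * Pt.eval (x ^ 2)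
          + c / 2 * Y.eval (x ^ 2)
            * (e.eval x * P.eval ((x - I * γ / 2) ^ 2)
              + estar.eval x * P.eval ((x + I * γ / 2) ^ 2))) := by
  intro x
  have a := h1 x
  have b := h2 x
  have hI : I ^ 2 = -1 := I_sq
  generalize X.eval ((x - I * γ / 2) ^ 2) = Xm at *
  generalize X.eval ((x + I * γ / 2) ^ 2) = Xp at *
  generalize P.eval ((x - I * γ / 2) ^ 2) = Pm at *
  generalize P.eval ((x + I * γ / 2) ^ 2) = Pp at *
  generalize Ξ.eval (x ^ 2) = u at *
  generalize Y.eval (x ^ 2) = y at *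
  generalize Pt.eval (x ^ 2) = t at *
  generalize e.eval x = e1 at *
  generalize estar.eval x = e2 at *
  linear_combination (-(Xm + Xp) / 2) * a + (I * c / 2 * (e1 * Pm + e2 * Pp)) * b
    - (c * γ * x * u * y * (e1 * Pm + e2 * Pp)) * hI
end

section
/- For every polynomial p over ℂ there exists a unique polynomial P over ℂ with P(0) = 0 such that P((x − i/2)²) − P((x + i/2)²) = ((x − i/2)² − (x + i/2)²)·p(x²) for all x ∈ ℂ; moreover deg P = deg p + 1. -/
open Polynomial Complex

theorem aux_h (n : ℕ) : ∃ h : ℂ[X], h.natDegree ≤ n ∧ h.coeff n = n + 1 ∧ ∀ x : ℂ,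
    ((x - I / 2) ^ 2) ^ (n + 1) - ((x + I / 2) ^ 2) ^ (n + 1) =
      ((x - I / 2) ^ 2 - (x + I / 2) ^ 2) * h.eval (x ^ 2) := by
  have hI : I ^ 2 = -1 := I_sq
  have s1 : ∀ x : ℂ, (x - I / 2) ^ 2 + (x + I / 2) ^ 2 = 2 * x ^ 2 + -1 / 2 := by
    intro x; linear_combination (1 / 2) * hI
  have s2 : ∀ x : ℂ, (x - I / 2) ^ 2 * (x + I / 2) ^ 2 = (x ^ 2 + 1 / 4) ^ 2 := by
    intro x
    have : (x - I / 2) * (x + I / 2) = x ^ 2 + 1 / 4 := by linear_combination (-1 / 4) * hI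
    rw [← mul_pow, this]
  induction n using Nat.twoStepInduction with
  | zero => exact ⟨1, by simp, by simp, by intro x; simp⟩
  | one =>
    refine ⟨C 2 * X + C (-1 / 2), natDegree_linear_le, by simp [coeff_C]; norm_num, fun x => ?_⟩
    have := s1 x
    simp only [eval_add, eval_mul, eval_C, eval_X]
    rw [← this]; ring
  | more n ih1 ih2 =>
    obtain ⟨a, ad, ac, ae⟩ := ih1
    obtain ⟨b, bd, bc, be⟩ := ih2
    have d1 : (C (2 : ℂ) * X + C (-1 / 2)).natDegree ≤ 1 := natDegree_linear_le
    have d2 : ((X + C (1 / 4 : ℂ)) ^ 2).natDegree ≤ 2 := by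
      rw [natDegree_pow, natDegree_X_add_C]
    have c2 : ((X + C (1 / 4 : ℂ)) ^ 2).coeff 2 = 1 := by
      have := (monic_X_add_C (1 / 4 : ℂ)).pow 2
      have h := this.coeff_natDegree
      rwa [natDegree_pow, natDegree_X_add_C] at h
    have c1 : (C (2 : ℂ) * X + C (-1 / 2)).coeff 1 = 2 := by simp [coeff_C]
    refine ⟨b * (C 2 * X + C (-1 / 2)) - a * (X + C (1 / 4)) ^ 2, ?_, ?_, fun x => ?_⟩
    · refine (natDegree_sub_le _ _).trans (max_le ?_ ?_)
      · exact natDegree_mul_le.trans (by omega)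
      · exact natDegree_mul_le.trans (by omega)
    · rw [coeff_sub, coeff_mul_add_eq_of_natDegree_le ad d2,
        show n + 2 = (n + 1) + 1 from rfl, coeff_mul_add_eq_of_natDegree_le bd d1, ac, bc, c1, c2]
      push_cast; ring
    · simp only [eval_sub, eval_add, eval_mul, eval_C, eval_X, eval_pow]
      rw [← s1 x, ← s2 x]
      have h1 := ae x
      have h2 := be x
      generalize (x - I / 2) ^ 2 = u at *
      generalize (x + I / 2) ^ 2 = v at *
      linear_combination (u + v) * h2 - u * v * h1

theorem aux_ex (n : ℕ) : ∀ p : ℂ[X], p.degree < n → ∃ P : ℂ[X], (P.coeff 0 = 0 ∧ ∀ x : ℂ,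
      P.eval ((x - I / 2) ^ 2) - P.eval ((x + I / 2) ^ 2) =
        ((x - I / 2) ^ 2 - (x + I / 2) ^ 2) * p.eval (x ^ 2)) ∧ P.degree = p.degree + 1 := by
  induction n with
  | zero =>
    intro p hp
    have : p = 0 := by
      rw [← degree_eq_bot]; simpa using hp
    subst this
    exact ⟨0, by simp, by simp⟩
  | succ n ih =>
    intro p hp
    by_cases hc : p.degree < n
    · exact ih p hc
    have hcz : p.coeff n ≠ 0 := by
      intro h0
      apply hc
      rw [degree_lt_iff_coeff_zero] at hp ⊢
      intro m hm
      rcases hm.eq_or_lt with rfl | h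
      · exact h0
      · exact hp m h
    have hpd : p.degree = n := by
      refine le_antisymm ?_ (le_degree_of_ne_zero hcz)
      rw [degree_lt_iff_coeff_zero] at hp
      refine (degree_le_iff_coeff_zero _ _).2 fun m hm => hp m ?_
      exact Nat.succ_le_of_lt (by exact_mod_cast hm)
    obtain ⟨h, hd, hco, he⟩ := aux_h n
    have hn : (n : ℂ) + 1 ≠ 0 := Nat.cast_add_one_ne_zero n
    set c := p.coeff n / (n + 1) with hcdef
    have hc0 : c ≠ 0 := div_ne_zero hcz hn
    have hq : (p - C c * h).degree < n := by
      rw [degree_lt_iff_coeff_zero] at hp ⊢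
      intro m hm
      rw [coeff_sub, coeff_C_mul]
      rcases hm.eq_or_lt with rfl | hlt
      · rw [hco, hcdef]; field_simp; ring
      · rw [hp m hlt, coeff_eq_zero_of_natDegree_lt (lt_of_le_of_lt hd hlt)]; simp
    obtain ⟨Q, ⟨Q0, Qe⟩, Qd⟩ := ih _ hq
    refine ⟨C c * X ^ (n + 1) + Q, ⟨by simp [Q0], fun x => ?_⟩, ?_⟩
    · have h1 := Qe x
      have h2 := he x
      simp only [eval_sub, eval_add, eval_mul, eval_C, eval_X, eval_pow] at *
      linear_combination h1 + c * h2
    · have e : (C c * X ^ (n + 1)).degree = ((n + 1 : ℕ) : WithBot ℕ) := degree_C_mul_X_pow _ hc0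
      rw [degree_add_eq_left_of_degree_lt, e, hpd]
      · rfl
      · rw [e, Qd]
        generalize (p - C c * h).degree = d at hq
        cases d with
        | bot => exact WithBot.bot_lt_coe _
        | coe d =>
          have : d < n := WithBot.coe_lt_coe.1 hq
          exact WithBot.coe_lt_coe.2 (Nat.succ_lt_succ this)

theorem aux_uniq (D : ℂ[X]) (h0 : D.coeff 0 = 0)
    (h : ∀ x : ℂ, D.eval ((x - I / 2) ^ 2) = D.eval ((x + I / 2) ^ 2)) : D = 0 := by
  have key : ∀ n : ℕ, D.eval (((n : ℂ) * I) ^ 2) = 0 := by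
    intro n
    induction n with
    | zero => simpa [coeff_zero_eq_eval_zero] using h0
    | succ n ih =>
      have := h ((n : ℂ) * I + I / 2)
      rw [show (n : ℂ) * I + I / 2 - I / 2 = n * I by ring, ih] at this
      rw [this]; congr 1; push_cast; ring
  refine eq_zero_of_infinite_isRoot D (Set.Infinite.mono (s := Set.range fun n : ℕ => ((n : ℂ) * I) ^ 2) ?_ ?_)
  · rintro _ ⟨n, rfl⟩
    exact key n
  · refine Set.infinite_range_of_injective fun a b hab => ?_
    simp only [mul_pow, I_sq, mul_neg, mul_one, neg_inj] at hab
    have : a ^ 2 = b ^ 2 := by exact_mod_cast hab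
    exact Nat.pow_left_injective (by norm_num : 2 ≠ 0) this

theorem stmt_8 (p : ℂ[X]) :
    (∃! P : ℂ[X], P.coeff 0 = 0 ∧ ∀ x : ℂ,
      P.eval ((x - I / 2) ^ 2) - P.eval ((x + I / 2) ^ 2) =
        ((x - I / 2) ^ 2 - (x + I / 2) ^ 2) * p.eval (x ^ 2)) ∧
    ∀ P : ℂ[X], P.coeff 0 = 0 →
      (∀ x : ℂ,
        P.eval ((x - I / 2) ^ 2) - P.eval ((x + I / 2) ^ 2) =
          ((x - I / 2) ^ 2 - (x + I / 2) ^ 2) * p.eval (x ^ 2)) →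
      P.degree = p.degree + 1 := by
  obtain ⟨P, ⟨P0, Pe⟩, Pd⟩ := aux_ex (p.natDegree + 1) p
    (lt_of_le_of_lt degree_le_natDegree (by exact_mod_cast Nat.lt_succ_self _))
  have uniq : ∀ Q : ℂ[X], Q.coeff 0 = 0 → (∀ x : ℂ,
        Q.eval ((x - I / 2) ^ 2) - Q.eval ((x + I / 2) ^ 2) =
          ((x - I / 2) ^ 2 - (x + I / 2) ^ 2) * p.eval (x ^ 2)) → Q = P := by
    intro Q Q0 Qe
    refine sub_eq_zero.1 (aux_uniq (Q - P) (by simp [Q0, P0]) fun x => ?_)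
    simp only [eval_sub]
    linear_combination Qe x - Pe x
  refine ⟨⟨P, ⟨P0, Pe⟩, fun Q hQ => uniq Q hQ.1 hQ.2⟩, fun Q Q0 Qe => ?_⟩
  rw [uniq Q Q0 Qe, Pd]
end

section
/- Fix q ∈ ℝ with 0 < q < 1. For every polynomial p over ℂ there exists a unique polynomial P over ℂ with P(0) = 0 such that P((q^{1/2} z + q^{-1/2} z⁻¹)/2) − P((q^{-1/2} z + q^{1/2} z⁻¹)/2) = ( (q^{1/2} z + q^{-1/2} z⁻¹)/2 − (q^{-1/2} z + q^{1/2} z⁻¹)/2 )·p((z + z⁻¹)/2) for all z ∈ ℂ, z ≠ 0; moreover deg P = deg p + 1. -/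
open Polynomial

/-- The difference relation between `P` and `p`, in the variable `z`. -/
def DiffRel (s : ℂ) (P p : ℂ[X]) : Prop :=
  ∀ z : ℂ, z ≠ 0 →
      P.eval ((s * z + s⁻¹ * z⁻¹) / 2) - P.eval ((s⁻¹ * z + s * z⁻¹) / 2) =
        ((s * z + s⁻¹ * z⁻¹) / 2 - (s⁻¹ * z + s * z⁻¹) / 2) * p.eval ((z + z⁻¹) / 2)

lemma T_eval_joukowski (z : ℂ) (hz : z ≠ 0) (n : ℕ) :
    (Chebyshev.T ℂ n).eval ((z + z⁻¹) / 2) = (z ^ n + (z ^ n)⁻¹) / 2 := by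
  induction n using Nat.twoStepInduction with
  | zero => simp
  | one => simp
  | more n h1 h2 =>
    have := Chebyshev.T_add_two ℂ n
    push_cast at *
    rw [this]
    simp only [eval_sub, eval_mul, eval_X, eval_ofNat, h1, h2]
    field_simp
    ring

lemma U_eval_joukowski (z : ℂ) (hz : z ≠ 0) (n : ℕ) :
    (z - z⁻¹) * (Chebyshev.U ℂ n).eval ((z + z⁻¹) / 2) = z ^ (n + 1) - (z ^ (n + 1))⁻¹ := by
  induction n using Nat.twoStepInduction with
  | zero => simp
  | one =>
    simp
    field_simp
    ring
  | more n h1 h2 =>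
    have := Chebyshev.U_add_two ℂ n
    push_cast at *
    rw [this]
    simp only [eval_sub, eval_mul, eval_X, eval_ofNat]
    have e : ∀ a b c : ℂ, (z - z⁻¹) * (2 * c * a - b) =
      2 * c * ((z - z⁻¹) * a) - (z - z⁻¹) * b := by intros; ring
    rw [e, h1, h2]
    field_simp
    ring

lemma diffRel_T_U (s : ℂ) (hs : s ≠ 0) (h1 : s - s⁻¹ ≠ 0) (n : ℕ) :
    DiffRel s (Chebyshev.T ℂ (n + 1 : ℕ))
      (C ((s ^ (n + 1) - (s ^ (n + 1))⁻¹) / (s - s⁻¹)) * Chebyshev.U ℂ n) := by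
  intro z hz
  have e1 := T_eval_joukowski (s * z) (mul_ne_zero hs hz) (n + 1)
  have e2 := T_eval_joukowski (s⁻¹ * z) (mul_ne_zero (inv_ne_zero hs) hz) (n + 1)
  have e3 := U_eval_joukowski z hz n
  rw [mul_inv] at e1
  rw [mul_inv, inv_inv] at e2
  rw [e1, e2, eval_mul, eval_C]
  have e : ((s * z + s⁻¹ * z⁻¹) / 2 - (s⁻¹ * z + s * z⁻¹) / 2) =
    (s - s⁻¹) * (z - z⁻¹) / 2 := by ring
  rw [e]
  have : ∀ a b c d : ℂ, b ≠ 0 → b * c / 2 * (a / b * d) = a * (c * d) / 2 := by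
    intro a b c d hb
    field_simp
  rw [this _ _ _ _ h1, e3]
  simp only [mul_pow, mul_inv, inv_pow, inv_inv]
  ring

lemma exists_diffRel (s : ℂ) (hs : s ≠ 0) (h1 : ∀ n : ℕ, s ^ (n + 1) - (s ^ (n + 1))⁻¹ ≠ 0)
    (n : ℕ) : ∀ p : ℂ[X], p.degree < n →
      ∃ P : ℂ[X], P.coeff 0 = 0 ∧ DiffRel s P p ∧ P.degree = p.degree + 1 := by
  induction n with
  | zero =>
    intro p hp
    have hp0 : p = 0 := by
      rw [← Polynomial.degree_eq_bot]
      simpa using hp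
    subst hp0
    exact ⟨0, by simp, by intro z hz; simp, by simp⟩
  | succ n ih =>
    intro p hp
    by_cases hpn : p.degree < n
    · exact ih p hpn
    have hdeg : p.degree = n := by
      apply le_antisymm _ (not_lt.mp hpn)
      have hnd : p.natDegree < n + 1 := (natDegree_lt_iff_degree_lt (fun h => hpn (by simp [h]))).mpr hp
      exact degree_le_of_natDegree_le (Nat.lt_succ_iff.mp hnd)
    have hU := Chebyshev.degree_U_natCast ℂ n
    have hlc : (Chebyshev.U ℂ n).coeff n ≠ 0 := coeff_ne_zero_of_eq_degree hU
    have hpc : p.coeff n ≠ 0 := coeff_ne_zero_of_eq_degree hdeg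
    set a := p.coeff n / (Chebyshev.U ℂ n).coeff n with ha
    have ha0 : a ≠ 0 := div_ne_zero hpc hlc
    set r := p - C a * Chebyshev.U ℂ n with hr
    have hrd : r.degree < n := by
      rw [degree_lt_iff_coeff_zero]
      intro m hm
      rcases hm.eq_or_lt with rfl | hm
      · simp only [hr, coeff_sub, coeff_C_mul, ha]
        field_simp
        simp
      · have hm' : (n : WithBot ℕ) < m := by exact_mod_cast hm
        simp [hr, coeff_eq_zero_of_degree_lt (hdeg.trans_lt hm'),
          coeff_eq_zero_of_degree_lt (hU.trans_lt hm')]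
    obtain ⟨Q, hQ0, hQ, hQd⟩ := ih r hrd
    have h10 : s - s⁻¹ ≠ 0 := by simpa using h1 0
    set c := (s ^ (n + 1) - (s ^ (n + 1))⁻¹) / (s - s⁻¹) with hc
    have hc0 : c ≠ 0 := div_ne_zero (h1 n) h10
    set t := Chebyshev.T ℂ (n + 1 : ℕ) with ht
    have htd : t.degree = (n + 1 : ℕ) := by
      rw [ht, Chebyshev.degree_T]; rfl
    have htd' : (t - C (t.coeff 0)).degree = (n + 1 : ℕ) := by
      rw [degree_sub_C, htd]
      rw [htd]; exact_mod_cast Nat.succ_pos n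
    refine ⟨C (a / c) * (t - C (t.coeff 0)) + Q, by simp [hQ0], ?_, ?_⟩
    · intro z hz
      have k1 := hQ z hz
      have k2 := diffRel_T_U s hs h10 n z hz
      rw [← hc, ← ht] at k2
      simp only [hr, eval_add, eval_mul, eval_C, eval_sub] at k1 k2 ⊢
      have k3 : a = (a / c) * c := by field_simp
      generalize a / c = b at *
      rw [k3] at k1
      linear_combination k1 + b * k2
    · have k : (C (a / c) * (t - C (t.coeff 0))).degree = (n + 1 : ℕ) := by
        rw [degree_C_mul (div_ne_zero ha0 hc0), htd']
      rw [degree_add_eq_left_of_degree_lt, k, hdeg]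
      · rfl
      · rw [k, hQd]
        by_cases hr0 : r = 0
        · rw [hr0, degree_zero]; exact WithBot.bot_lt_coe _
        · rw [degree_eq_natDegree hr0] at hrd ⊢
          norm_cast at hrd ⊢
          omega

lemma diffRel_zero (s : ℝ) (hs : 0 < s) (hs1 : s < 1) (P : ℂ[X]) (h0 : P.coeff 0 = 0)
    (h : DiffRel s P 0) : P = 0 := by
  have hsc : (s : ℂ) ≠ 0 := by exact_mod_cast hs.ne'
  let f : ℕ → ℂ := fun n => (((s ^ 2) ^ n + ((s ^ 2) ^ n)⁻¹ : ℝ) : ℂ) / 2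
  have hf : Function.Injective f := by
    have hq0 : 0 < s ^ 2 := by positivity
    have hq1 : s ^ 2 < 1 := by nlinarith
    have key : ∀ m n, m < n → f m ≠ f n := by
      intro m n hmn hfe
      have e : (s ^ 2) ^ m + ((s ^ 2) ^ m)⁻¹ = (s ^ 2) ^ n + ((s ^ 2) ^ n)⁻¹ := by
        have : (((s ^ 2) ^ m + ((s ^ 2) ^ m)⁻¹ : ℝ) : ℂ) = ((s ^ 2) ^ n + ((s ^ 2) ^ n)⁻¹ : ℝ) :=
          (div_left_inj' two_ne_zero).mp hfe
        exact_mod_cast this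
      have a0 : 0 < (s ^ 2) ^ n := by positivity
      have ab : (s ^ 2) ^ n < (s ^ 2) ^ m := pow_lt_pow_right_of_lt_one₀ hq0 hq1 hmn
      have b1 : (s ^ 2) ^ m ≤ 1 := pow_le_one₀ hq0.le hq1.le
      generalize (s ^ 2) ^ m = b at *
      generalize (s ^ 2) ^ n = a at *
      have b0 : 0 < b := a0.trans ab
      field_simp at e
      have : (b - a) * (a * b - 1) = 0 := by linear_combination e
      rcases mul_eq_zero.mp this with h | h
      · linarith
      · nlinarith
    intro m n hmn
    rcases lt_trichotomy m n with h | h | h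
    · exact absurd hmn (key _ _ h)
    · exact h
    · exact absurd hmn.symm (key _ _ h)
  have hv : ∀ n, P.eval (f n) = P.eval (f 0) := by
    intro n
    induction n with
    | zero => rfl
    | succ n ih =>
      rw [← ih]
      have := h (s * ((s : ℂ) ^ 2) ^ n) (by positivity)
      rw [eval_zero, mul_zero, sub_eq_zero] at this
      convert this using 2
      · simp only [f]; push_cast; field_simp; ring
      · simp only [f]; push_cast; field_simp
  have hz : P - C (P.eval (f 0)) = 0 := by
    apply eq_zero_of_infinite_isRoot
    apply (Set.infinite_range_of_injective hf).mono
    rintro _ ⟨n, rfl⟩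
    simp [IsRoot, hv n]
  have hP := sub_eq_zero.mp hz
  rw [hP, coeff_C_zero] at h0
  rw [hP, h0, C_0]

theorem stmt_9 (q : ℝ) (hq0 : 0 < q) (hq1 : q < 1) (p : ℂ[X]) :
    (∃! P : ℂ[X], P.coeff 0 = 0 ∧ ∀ z : ℂ, z ≠ 0 →
      P.eval (((Real.sqrt q : ℂ) * z + (Real.sqrt q : ℂ)⁻¹ * z⁻¹) / 2)
          - P.eval (((Real.sqrt q : ℂ)⁻¹ * z + (Real.sqrt q : ℂ) * z⁻¹) / 2) =
        (((Real.sqrt q : ℂ) * z + (Real.sqrt q : ℂ)⁻¹ * z⁻¹) / 2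
            - ((Real.sqrt q : ℂ)⁻¹ * z + (Real.sqrt q : ℂ) * z⁻¹) / 2)
          * p.eval ((z + z⁻¹) / 2)) ∧
    ∀ P : ℂ[X], P.coeff 0 = 0 →
      (∀ z : ℂ, z ≠ 0 →
        P.eval (((Real.sqrt q : ℂ) * z + (Real.sqrt q : ℂ)⁻¹ * z⁻¹) / 2)
            - P.eval (((Real.sqrt q : ℂ)⁻¹ * z + (Real.sqrt q : ℂ) * z⁻¹) / 2) =
          (((Real.sqrt q : ℂ) * z + (Real.sqrt q : ℂ)⁻¹ * z⁻¹) / 2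
              - ((Real.sqrt q : ℂ)⁻¹ * z + (Real.sqrt q : ℂ) * z⁻¹) / 2)
            * p.eval ((z + z⁻¹) / 2)) →
      P.degree = p.degree + 1 := by
  have hs : 0 < Real.sqrt q := Real.sqrt_pos.mpr hq0
  have hs1 : Real.sqrt q < 1 := by
    rw [Real.sqrt_lt' one_pos]; simpa using hq1
  have hsc : (Real.sqrt q : ℂ) ≠ 0 := by exact_mod_cast hs.ne'
  have h1 : ∀ n : ℕ, (Real.sqrt q : ℂ) ^ (n + 1) - ((Real.sqrt q : ℂ) ^ (n + 1))⁻¹ ≠ 0 := by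
    intro n hn
    have e : Real.sqrt q ^ (n + 1) - (Real.sqrt q ^ (n + 1))⁻¹ = 0 := by exact_mod_cast hn
    have a1 : Real.sqrt q ^ (n + 1) < 1 := pow_lt_one₀ hs.le hs1 (Nat.succ_ne_zero n)
    have a0 : 0 < Real.sqrt q ^ (n + 1) := pow_pos hs _
    have a2 := one_lt_inv₀ a0 |>.mpr a1
    linarith
  have huniq : ∀ P Q : ℂ[X], P.coeff 0 = 0 → Q.coeff 0 = 0 → DiffRel (Real.sqrt q) P p →
      DiffRel (Real.sqrt q) Q p → P = Q := by
    intro P Q hP0 hQ0 hP hQ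
    apply sub_eq_zero.mp
    apply diffRel_zero _ hs hs1 _ (by simp [hP0, hQ0])
    intro z hz
    have k1 := hP z hz
    have k2 := hQ z hz
    simp only [eval_sub, eval_zero]
    linear_combination k1 - k2
  obtain ⟨P, hP0, hP, hPd⟩ := exists_diffRel (Real.sqrt q) hsc h1 (p.natDegree + 1) p
    (degree_le_natDegree.trans_lt (by exact_mod_cast Nat.lt_succ_self _))
  refine ⟨⟨P, ⟨hP0, hP⟩, fun Q hQ => huniq Q P hQ.1 hP0 hQ.2 hP⟩, fun Q hQ0 hQ => ?_⟩
  rw [huniq Q P hQ0 hP0 hQ hP, hPd]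
end

section
/- For every natural number n and every complex number x, (x − i/2)^{2n+2} − (x + i/2)^{2n+2} = ( (x − i/2)² − (x + i/2)² ) · Σ_{k=0}^{n} (−1)^k · 2^{−(2k+1)} · C(2n+2, 2k+1) · x^{2(n−k)}, where C(·,·) denotes the binomial coefficient. -/
open Complex

lemma sum_even_odd_aux (f : ℕ → ℂ) (m : ℕ) :
    ∑ j ∈ Finset.range (2 * m), f j
      = ∑ k ∈ Finset.range m, (f (2 * k) + f (2 * k + 1)) := by
  induction m with
  | zero => simp
  | succ m ih =>
    rw [show 2 * (m + 1) = 2 * m + 1 + 1 by ring, Finset.sum_range_succ, Finset.sum_range_succ,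
      Finset.sum_range_succ, ih]
    ring

theorem stmt_10 (n : ℕ) (x : ℂ) :
    (x - I / 2) ^ (2 * n + 2) - (x + I / 2) ^ (2 * n + 2) =
      ((x - I / 2) ^ 2 - (x + I / 2) ^ 2) *
        ∑ k ∈ Finset.range (n + 1),
          (-1 : ℂ) ^ k * (2 : ℂ) ^ (-(2 * (k : ℤ) + 1)) *
            (Nat.choose (2 * n + 2) (2 * k + 1) : ℂ) * x ^ (2 * (n - k)) := by
  rw [show x - I / 2 = -(I / 2) + x by ring, show x + I / 2 = I / 2 + x by ring,
    add_pow (-(I / 2)) x (2 * n + 2), add_pow (I / 2) x (2 * n + 2), ← Finset.sum_sub_distrib,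
    Finset.sum_range_succ, show 2 * n + 2 = 2 * (n + 1) by ring, sum_even_odd_aux, Finset.mul_sum]
  have he : ∀ k : ℕ, (-(I / 2)) ^ (2 * k) = (I / 2) ^ (2 * k) := fun k =>
    (even_two_mul k).neg_pow _
  rw [he, sub_self, add_zero]
  refine Finset.sum_congr rfl fun k hk => ?_
  have hk' : k ≤ n := by simpa [Nat.lt_succ_iff] using hk
  have hz : (2 : ℂ) ^ (-(2 * (k : ℤ) + 1)) = ((2 : ℂ) ^ (2 * k + 1))⁻¹ := by
    rw [zpow_neg]; norm_cast
  have hI : (I / 2) ^ (2 * k + 1) = I * (-1) ^ k * ((2 : ℂ) ^ (2 * k + 1))⁻¹ := by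
    rw [div_pow, pow_succ I, pow_mul, I_sq]; ring
  have ho : (-(I / 2)) ^ (2 * k + 1) = -(I / 2) ^ (2 * k + 1) :=
    (odd_two_mul_add_one k).neg_pow _
  rw [he, sub_self, zero_add, ho, hI, hz,
    show 2 * (n + 1) - (2 * k + 1) = 2 * (n - k) + 1 by omega, pow_succ x]
  ring
end

section
/- Let a ∈ ℂ, a ≠ 0, and let S be a polynomial in two variables over ℂ which is symmetric, S(u, v) = S(v, u). Then there exists a polynomial r in one variable over ℂ such that S( (a z + a⁻¹ z⁻¹)/2, (a⁻¹ z + a z⁻¹)/2 ) = r( (z + z⁻¹)/2 ) for all z ∈ ℂ, z ≠ 0. -/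
open Polynomial

theorem aux_pow (A B : ℂ[X]) (i k : ℕ) : ∃ r : ℂ[X], ∀ x u v : ℂ,
    u + v = A.eval x → u * v = B.eval x → u ^ i * v ^ (i + k) + v ^ i * u ^ (i + k) = r.eval x := by
  have h0 : ∀ k : ℕ, (∃ r : ℂ[X], ∀ x u v : ℂ,
      u + v = A.eval x → u * v = B.eval x → u ^ k + v ^ k = r.eval x) ∧
      (∃ r : ℂ[X], ∀ x u v : ℂ,
      u + v = A.eval x → u * v = B.eval x → u ^ (k + 1) + v ^ (k + 1) = r.eval x) := by
    intro k
    induction k with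
    | zero =>
      refine ⟨⟨C 2, fun x u v _ _ => ?_⟩, ⟨A, fun x u v h _ => ?_⟩⟩
      · simp only [pow_zero, eval_C]; norm_num
      · simpa using h
    | succ k ih =>
      obtain ⟨⟨r, hr⟩, ⟨t, ht⟩⟩ := ih
      refine ⟨⟨t, ht⟩, ⟨A * t - B * r, fun x u v h1 h2 => ?_⟩⟩
      rw [eval_sub, eval_mul, eval_mul, ← h1, ← h2, ← hr x u v h1 h2, ← ht x u v h1 h2]
      ring
  obtain ⟨⟨r, hr⟩, -⟩ := h0 k
  refine ⟨B ^ i * r, fun x u v h1 h2 => ?_⟩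
  rw [eval_mul, eval_pow, ← h2, ← hr x u v h1 h2]
  ring

theorem aux_sym (A B : ℂ[X]) (S : MvPolynomial (Fin 2) ℂ) : ∃ r : ℂ[X], ∀ x u v : ℂ,
    u + v = A.eval x → u * v = B.eval x →
    MvPolynomial.eval ![u, v] S + MvPolynomial.eval ![v, u] S = r.eval x := by
  induction S using MvPolynomial.induction_on' with
  | monomial m c =>
    have key : ∃ r : ℂ[X], ∀ x u v : ℂ, u + v = A.eval x → u * v = B.eval x →
        u ^ m 0 * v ^ m 1 + v ^ m 0 * u ^ m 1 = r.eval x := by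
      rcases le_total (m 0) (m 1) with h | h
      · obtain ⟨k, hk⟩ := Nat.exists_eq_add_of_le h
        rw [hk]
        exact aux_pow A B _ k
      · obtain ⟨k, hk⟩ := Nat.exists_eq_add_of_le h
        rw [hk]
        obtain ⟨r, hr⟩ := aux_pow A B (m 1) k
        refine ⟨r, fun x u v h1 h2 => ?_⟩
        rw [← hr x u v h1 h2]
        ring
    obtain ⟨r, hr⟩ := key
    refine ⟨C c * r, fun x u v h1 h2 => ?_⟩
    rw [eval_mul, eval_C, ← hr x u v h1 h2, MvPolynomial.eval_monomial,
      MvPolynomial.eval_monomial, Finsupp.prod_fintype _ _ (by simp),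
      Finsupp.prod_fintype _ _ (by simp)]
    simp [Fin.prod_univ_two]
    ring
  | add p q hp hq =>
    obtain ⟨r, hr⟩ := hp
    obtain ⟨t, ht⟩ := hq
    refine ⟨r + t, fun x u v h1 h2 => ?_⟩
    rw [eval_add, ← hr x u v h1 h2, ← ht x u v h1 h2, map_add, map_add]
    ring

theorem stmt_13 (a : ℂ) (ha : a ≠ 0) (S : MvPolynomial (Fin 2) ℂ)
    (hS : ∀ u v : ℂ, MvPolynomial.eval ![u, v] S = MvPolynomial.eval ![v, u] S) :
    ∃ r : ℂ[X], ∀ z : ℂ, z ≠ 0 →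
      MvPolynomial.eval
          ![(a * z + a⁻¹ * z⁻¹) / 2, (a⁻¹ * z + a * z⁻¹) / 2] S =
        r.eval ((z + z⁻¹) / 2) := by
  obtain ⟨r, hr⟩ := aux_sym (C (a + a⁻¹) * X) (X ^ 2 + C ((a - a⁻¹) ^ 2 / 4)) S
  refine ⟨C (1 / 2) * r, fun z hz => ?_⟩
  rw [eval_mul, eval_C, ← hr _ ((a * z + a⁻¹ * z⁻¹) / 2) ((a⁻¹ * z + a * z⁻¹) / 2),
    ← hS ((a * z + a⁻¹ * z⁻¹) / 2)]
  · ring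
  · simp only [eval_mul, eval_C, eval_X]
    ring
  · simp only [eval_add, eval_pow, eval_C, eval_X]
    field_simp
    ring
end

section
/- Let c ∈ ℂ, c ≠ 0, and let p₁, p₂ be polynomials in one variable over ℂ. Then there exists a polynomial u over ℂ such that p₁((x − 2c)²)·p₂((x − c)²) − p₁((x + 2c)²)·p₂((x + c)²) = ( (x − c)² − (x + c)² )·u(x²) for all x ∈ ℂ. -/
open Polynomial

theorem even_odd_split (q : ℂ[X]) :
    ∃ a b : ℂ[X], ∀ x : ℂ, q.eval x = a.eval (x ^ 2) + x * b.eval (x ^ 2) := by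
  induction q using Polynomial.induction_on with
  | C r => exact ⟨C r, 0, fun x => by simp⟩
  | add p q hp hq =>
    obtain ⟨a, b, h⟩ := hp
    obtain ⟨a', b', h'⟩ := hq
    exact ⟨a + a', b + b', fun x => by simp only [eval_add, h, h']; ring⟩
  | monomial n r hr =>
    obtain ⟨a, b, h⟩ := hr
    refine ⟨X * b, a, fun x => ?_⟩
    have := h x
    rw [pow_succ, ← mul_assoc, eval_mul, this]
    simp only [eval_mul, eval_X]
    ring

theorem stmt_14 (c : ℂ) (hc : c ≠ 0) (p₁ p₂ : ℂ[X]) :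
    ∃ u : ℂ[X], ∀ x : ℂ,
      p₁.eval ((x - 2 * c) ^ 2) * p₂.eval ((x - c) ^ 2)
          - p₁.eval ((x + 2 * c) ^ 2) * p₂.eval ((x + c) ^ 2) =
        ((x - c) ^ 2 - (x + c) ^ 2) * u.eval (x ^ 2) := by
  obtain ⟨a, b, h⟩ := even_odd_split
    (p₁.comp ((X + C (2 * c)) ^ 2) * p₂.comp ((X + C c) ^ 2))
  refine ⟨C (1 / (2 * c)) * b, fun x => ?_⟩
  have h1 := h x
  have h2 := h (-x)
  simp only [eval_mul, eval_comp, eval_pow, eval_add, eval_X, eval_C] at h1 h2 ⊢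
  rw [show (-x + 2 * c) ^ 2 = (x - 2 * c) ^ 2 by ring,
    show (-x + c) ^ 2 = (x - c) ^ 2 by ring, neg_sq] at h2
  rw [h1, h2]
  field_simp
  ring
end

section
/- Let c ∈ ℂ, c ≠ 0, and let Ξ, p be polynomials in one variable over ℂ. Then there exist polynomials X and Y over ℂ such that for all x ∈ ℂ: (a) X(x²) = Ξ((x − c)²)·Ξ((x + c)²)·p(x²), (b) Ξ((x − 2c)²)·p((x − c)²) − Ξ((x + 2c)²)·p((x + c)²) = ( (x − c)² − (x + c)² )·Y(x²), and (c) X((x − c)²) − X((x + c)²) = ( (x − c)² − (x + c)² )·Ξ(x²)·Y(x²). -/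
open Polynomial

theorem even_odd_decomp (F : ℂ[X]) :
    ∃ A B : ℂ[X], ∀ x : ℂ, F.eval x = A.eval (x ^ 2) + x * B.eval (x ^ 2) := by
  induction F using Polynomial.induction_on with
  | C a => exact ⟨C a, 0, fun x => by simp⟩
  | add p q hp hq =>
    obtain ⟨A, B, h⟩ := hp
    obtain ⟨A', B', h'⟩ := hq
    exact ⟨A + A', B + B', fun x => by rw [eval_add, h, h', eval_add, eval_add]; ring⟩
  | monomial n a ih =>
    obtain ⟨A, B, h⟩ := ih
    refine ⟨X * B, A, fun x => ?_⟩
    rw [pow_succ, ← mul_assoc, eval_mul, h, eval_mul, eval_X, eval_X]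
    ring

theorem stmt_15 (c : ℂ) (hc : c ≠ 0) (Ξ p : ℂ[X]) :
    ∃ X Y : ℂ[X], ∀ x : ℂ,
      (X.eval (x ^ 2) = Ξ.eval ((x - c) ^ 2) * Ξ.eval ((x + c) ^ 2) * p.eval (x ^ 2)) ∧
      (Ξ.eval ((x - 2 * c) ^ 2) * p.eval ((x - c) ^ 2)
          - Ξ.eval ((x + 2 * c) ^ 2) * p.eval ((x + c) ^ 2) =
        ((x - c) ^ 2 - (x + c) ^ 2) * Y.eval (x ^ 2)) ∧
      (X.eval ((x - c) ^ 2) - X.eval ((x + c) ^ 2) =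
        ((x - c) ^ 2 - (x + c) ^ 2) * Ξ.eval (x ^ 2) * Y.eval (x ^ 2)) := by
  obtain ⟨A, A', hA⟩ := even_odd_decomp
    (Ξ.comp ((X - C c) ^ 2) * Ξ.comp ((X + C c) ^ 2) * p.comp (X ^ 2))
  obtain ⟨B', B, hB⟩ := even_odd_decomp
    (Ξ.comp ((X - C (2 * c)) ^ 2) * p.comp ((X - C c) ^ 2))
  simp only [eval_mul, eval_comp, eval_pow, eval_sub, eval_add, eval_X, eval_C] at hA hB
  have ha : ∀ x : ℂ, A.eval (x ^ 2) =
      Ξ.eval ((x - c) ^ 2) * Ξ.eval ((x + c) ^ 2) * p.eval (x ^ 2) := by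
    intro x
    have h1 := hA x
    have h2 := hA (-x)
    rw [show (-x - c) ^ 2 = (x + c) ^ 2 by ring, show (-x + c) ^ 2 = (x - c) ^ 2 by ring,
      show (-x) ^ 2 = x ^ 2 by ring] at h2
    linear_combination (-1 / 2) * h1 - (1 / 2) * h2
  have hb : ∀ x : ℂ, Ξ.eval ((x - 2 * c) ^ 2) * p.eval ((x - c) ^ 2)
          - Ξ.eval ((x + 2 * c) ^ 2) * p.eval ((x + c) ^ 2) =
        ((x - c) ^ 2 - (x + c) ^ 2) * (C (-1 / (2 * c)) * B).eval (x ^ 2) := by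
    intro x
    have h1 := hB x
    have h2 := hB (-x)
    rw [show (-x - c) ^ 2 = (x + c) ^ 2 by ring,
      show (-x - 2 * c) ^ 2 = (x + 2 * c) ^ 2 by ring,
      show (-x) ^ 2 = x ^ 2 by ring] at h2
    rw [h1, h2, eval_mul, eval_C]
    field_simp
    ring
  refine ⟨A, C (-1 / (2 * c)) * B, fun x => ⟨ha x, hb x, ?_⟩⟩
  have h := hb x
  rw [ha (x - c), ha (x + c), show x - c - c = x - 2 * c by ring,
    show x + c + c = x + 2 * c by ring, show x - c + c = x by ring,
    show x + c - c = x by ring]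
  linear_combination (Ξ.eval (x ^ 2)) * h
end

section
/- Let a ∈ ℂ, a ≠ 0, and let p₁, p₂ be polynomials in one variable over ℂ. Then there exists a polynomial r over ℂ such that z·p₁( (a⁻¹ z + a z⁻¹)/2 )·p₂( (a z + a⁻¹ z⁻¹)/2 ) + z⁻¹·p₁( (a z + a⁻¹ z⁻¹)/2 )·p₂( (a⁻¹ z + a z⁻¹)/2 ) = r( (z + z⁻¹)/2 ) for all z ∈ ℂ, z ≠ 0. -/
open Polynomial

lemma aux_decomp (a : ℂ) (p : ℂ[X]) :
    ∃ A B : ℂ[X], ∀ z w : ℂ, z * w = 1 →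
      p.eval ((a⁻¹ * z + a * w) / 2) = A.eval ((z + w) / 2) + B.eval ((z + w) / 2) * z := by
  induction p using Polynomial.induction_on with
  | C c => exact ⟨C c, 0, by simp⟩
  | add p q hp hq =>
    obtain ⟨A, B, h⟩ := hp
    obtain ⟨A', B', h'⟩ := hq
    refine ⟨A + A', B + B', fun z w hzw => ?_⟩
    simp only [eval_add, h z w hzw, h' z w hzw]
    ring
  | monomial n c ih =>
    obtain ⟨A, B, h⟩ := ih
    refine ⟨C a * X * A - C ((a⁻¹ - a) / 2) * B,
      C a * X * B + C ((a⁻¹ - a) / 2) * A + C (a⁻¹ - a) * X * B, fun z w hzw => ?_⟩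
    have h1 := h z w hzw
    rw [pow_succ, ← mul_assoc, eval_mul, h1]
    simp only [eval_add, eval_sub, eval_mul, eval_C, eval_X]
    generalize eval ((z + w) / 2) A = s
    generalize eval ((z + w) / 2) B = t
    linear_combination (-(a⁻¹ - a) / 2 * t) * hzw

theorem stmt_16 (a : ℂ) (ha : a ≠ 0) (p₁ p₂ : ℂ[X]) :
    ∃ r : ℂ[X], ∀ z : ℂ, z ≠ 0 →
      z * p₁.eval ((a⁻¹ * z + a * z⁻¹) / 2) * p₂.eval ((a * z + a⁻¹ * z⁻¹) / 2)
          + z⁻¹ * p₁.eval ((a * z + a⁻¹ * z⁻¹) / 2)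
            * p₂.eval ((a⁻¹ * z + a * z⁻¹) / 2) =
        r.eval ((z + z⁻¹) / 2) := by
  obtain ⟨A, B, h⟩ := aux_decomp a p₁
  obtain ⟨E, D, h'⟩ := aux_decomp a p₂
  refine ⟨C 2 * X * (A * E + B * D) + C 2 * A * D + (C 4 * X ^ 2 - C 2) * B * E,
    fun z hz => ?_⟩
  have hzw : z * z⁻¹ = 1 := mul_inv_cancel₀ hz
  generalize z⁻¹ = w at *
  have hwz : w * z = 1 := by rw [mul_comm]; exact hzw
  rw [add_comm (a * z), h z w hzw, h' z w hzw, h w z hwz, h' w z hwz, add_comm w z]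
  simp only [eval_add, eval_sub, eval_mul, eval_C, eval_X, eval_pow]
  generalize eval ((z + w) / 2) A = s
  generalize eval ((z + w) / 2) B = t
  generalize eval ((z + w) / 2) E = u
  generalize eval ((z + w) / 2) D = v
  linear_combination (2 * s * v - 2 * t * u + t * v * (z + w)) * hzw
end
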